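/- Let D be a domain in ℝⁿ with weight w, and suppose that for some p₀ ≥ 1 and q₀ ≥ 1 the embedding operator W^1_{p₀}(D,w) ↪ L_{q₀}(D,w) is bounded. Let p ≥ p₀ with 1/p > 1/p₀ − 1/q₀, and let q satisfy 1/p − 1/q = 1/p₀ − 1/q₀. Then the embedding operator W^1_p(D,w) ↪ L_q(D,w) is also bounded. -/

import Mathlib

open MeasureTheory Metric Set Filter
open scoped ENNReal Topology

noncomputable section

/-- Euclidean space `ℝⁿ`. -/
abbrev Euc (n : ℕ) := EuclideanSpace ℝ (Fin n)

/-- A weight: a locally summable nonnegative function on `ℝⁿ`. -/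
structure IsWeight {n : ℕ} (w : Euc n → ℝ) : Prop where
  nonneg : ∀ x, 0 ≤ w x
  locInt : LocallyIntegrable w volume

/-- `g` is the weak `i`-th partial derivative of `f` on `D`, i.e.
`∫_D f ∂_i η = -∫_D g η` for all test functions `η ∈ C_0^∞(D)`. -/
def IsWeakPartialDeriv {n : ℕ} (D : Set (Euc n)) (f g : Euc n → ℝ) (i : Fin n) : Prop :=
  ∀ η : Euc n → ℝ, ContDiff ℝ (⊤ : ℕ∞) η → HasCompactSupport η → tsupport η ⊆ D →
    ∫ x in D, f x * fderiv ℝ η x (EuclideanSpace.single i 1) = - ∫ x in D, g x * η x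

/-- `G` is the weak gradient of `f` on `D`. -/
def IsWeakGradient {n : ℕ} (D : Set (Euc n)) (f : Euc n → ℝ) (G : Euc n → Euc n) : Prop :=
  ∀ i : Fin n, IsWeakPartialDeriv D f (fun x => G x i) i

/-- The weighted Lebesgue norm `‖f | L_p(D,w)‖ = (∫_D |f|^p w)^{1/p}`. -/
def wLpNorm {n : ℕ} (D : Set (Euc n)) (w : Euc n → ℝ) (p : ℝ) (f : Euc n → ℝ) : ℝ :=
  (∫ x in D, |f x| ^ p * w x) ^ (1 / p)

/-- The weighted Sobolev norm of `f` with weak gradient `G`: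
`(∫_D |f|^p w)^{1/p} + (∫_D |∇f|^p w)^{1/p}`. -/
def W1Norm {n : ℕ} (D : Set (Euc n)) (w : Euc n → ℝ) (p : ℝ)
    (f : Euc n → ℝ) (G : Euc n → Euc n) : ℝ :=
  wLpNorm D w p f + wLpNorm D w p (fun x => ‖G x‖)

/-- Membership `f ∈ W^1_p(D,w)` with weak gradient `G`. -/
structure MemW1p {n : ℕ} (D : Set (Euc n)) (w : Euc n → ℝ) (p : ℝ)
    (f : Euc n → ℝ) (G : Euc n → Euc n) : Prop where
  locInt : LocallyIntegrableOn f D volume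
  grad : IsWeakGradient D f G
  int_f : IntegrableOn (fun x => |f x| ^ p * w x) D volume
  int_g : IntegrableOn (fun x => ‖G x‖ ^ p * w x) D volume

/-- Boundedness of the embedding operator `W^1_p(D,w) ↪ L_s(D,v)`. -/
def BddEmb {n : ℕ} (D : Set (Euc n)) (w v : Euc n → ℝ) (p s : ℝ) : Prop :=
  ∃ C > 0, ∀ f G, MemW1p D w p f G →
    IntegrableOn (fun x => |f x| ^ s * v x) D volume ∧
    wLpNorm D v s f ≤ C * W1Norm D w p f G

/-- Compactness of the embedding operator `W^1_p(D,w) ↪ L_s(D,v)` : every sequence in the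
unit ball of `W^1_p(D,w)` has a subsequence converging in `L_s(D,v)`. -/
def CptEmb {n : ℕ} (D : Set (Euc n)) (w v : Euc n → ℝ) (p s : ℝ) : Prop :=
  ∀ (f : ℕ → Euc n → ℝ) (G : ℕ → Euc n → Euc n),
    (∀ k, MemW1p D w p (f k) (G k)) →
    (∀ k, W1Norm D w p (f k) (G k) ≤ 1) →
    ∃ σ : ℕ → ℕ, StrictMono σ ∧ ∃ h : Euc n → ℝ,
      Tendsto (fun j => wLpNorm D v s (fun x => f (σ j) x - h x)) atTop (𝓝 0)

/-- A `Q`-quasiisometric homeomorphism of `D` onto `D'`. -/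
structure IsQIHomeo {n : ℕ} (Q : ℝ) (D D' : Set (Euc n)) (φ : Euc n → Euc n) : Prop where
  Qpos : 0 < Q
  bijOn : Set.BijOn φ D D'
  contOn : ContinuousOn φ D
  inv_cont : ∃ ψ : Euc n → Euc n, Set.InvOn ψ φ D D' ∧ ContinuousOn ψ D'
  lower : ∀ x ∈ D, 1 / Q ≤ liminf (fun z => ‖φ x - φ z‖ / ‖x - z‖) (𝓝[D \ {x}] x)
  upper : ∀ x ∈ D, limsup (fun z => ‖φ x - φ z‖ / ‖x - z‖) (𝓝[D \ {x}] x) ≤ Q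

/-- An embedding domain: a bounded domain supporting the Sobolev–Poincaré inequality for all
`1 ≤ q < n` and `r ≤ nq/(n-q)`; for such domains the (unweighted) embedding
`W^1_q(D) ↪ L_r(D)` is compact for every `r < nq/(n-q)`. -/
structure IsEmbeddingDomain (n : ℕ) (D : Set (Euc n)) : Prop where
  isOpen : IsOpen D
  isConnected : IsConnected D
  isBounded : Bornology.IsBounded D
  poincare : ∀ q r : ℝ, 1 ≤ q → q < n → 1 ≤ r → r ≤ (n : ℝ) * q / ((n : ℝ) - q) →
    ∃ M > 0, ∀ (f : Euc n → ℝ) (G : Euc n → Euc n),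
      LocallyIntegrableOn f D volume → IsWeakGradient D f G →
      IntegrableOn (fun x => ‖G x‖ ^ q) D volume →
      (⨅ c : ℝ, (∫ x in D, |f x - c| ^ r) ^ (1 / r)) ≤ M * (∫ x in D, ‖G x‖ ^ q) ^ (1 / q)
  cptEmb : ∀ q r : ℝ, 1 ≤ q → q < n → 1 ≤ r → r < (n : ℝ) * q / ((n : ℝ) - q) →
    CptEmb D (fun _ => 1) (fun _ => 1) q r


/-- Scheffé's lemma for real-valued sequences. -/
theorem tendsto_integral_abs_sub_of_nonneg {α : Type*} [MeasurableSpace α] {μ : Measure α}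
    {F : ℕ → α → ℝ} {h : α → ℝ} (hF : ∀ k, Integrable (F k) μ) (hh : Integrable h μ)
    (hF0 : ∀ k x, 0 ≤ F k x) (hh0 : ∀ x, 0 ≤ h x)
    (hint : ∀ k, ∫ x, F k x ∂μ = ∫ x, h x ∂μ)
    (hlim : ∀ᵐ x ∂μ, Tendsto (fun k => F k x) atTop (𝓝 (h x))) :
    Tendsto (fun k => ∫ x, |F k x - h x| ∂μ) atTop (𝓝 0) := by
  have key : ∀ k, ∫ x, |F k x - h x| ∂μ = 2 * ∫ x, max (h x - F k x) 0 ∂μ := by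
    intro k
    have hd : Integrable (fun x => h x - F k x) μ := hh.sub (hF k)
    have h1 : ∀ x, |F k x - h x| = 2 * max (h x - F k x) 0 - (h x - F k x) := by
      intro x
      rcases le_total (h x) (F k x) with hx | hx
      · rw [abs_of_nonneg (by linarith), max_eq_right (by linarith)]; ring
      · rw [abs_of_nonpos (by linarith), max_eq_left (by linarith)]; ring
    simp_rw [h1]
    rw [integral_sub (hd.pos_part.const_mul 2) hd, integral_const_mul,
      integral_sub hh (hF k), hint k]
    ring
  simp_rw [key]
  suffices H : Tendsto (fun k => ∫ x, max (h x - F k x) 0 ∂μ) atTop (𝓝 (∫ _, (0 : ℝ) ∂μ)) by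
    simpa using H.const_mul 2
  refine tendsto_integral_of_dominated_convergence h ?_ hh ?_ ?_
  · exact fun k => (hh.sub (hF k)).pos_part.aestronglyMeasurable
  · refine fun k => Eventually.of_forall fun x => ?_
    rw [Real.norm_eq_abs, abs_of_nonneg (le_max_right _ _)]
    exact max_le (by linarith [hF0 k x]) (hh0 x)
  · filter_upwards [hlim] with x hx
    simpa using (tendsto_const_nhds (x := h x)).sub hx |>.max (tendsto_const_nhds (x := (0 : ℝ)))

/-- The mollification of `u` by a normalised bump function. -/
def mollify {n : ℕ} (φ : ContDiffBump (0 : Euc n)) (u : Euc n → ℝ) (x : Euc n) : ℝ :=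
  ∫ t, u t * φ.normed volume (x - t)

theorem mollify_eq_convolution_right {n : ℕ} (φ : ContDiffBump (0 : Euc n)) (u : Euc n → ℝ) :
    mollify φ u = convolution u (φ.normed volume) (ContinuousLinearMap.mul ℝ ℝ) volume := rfl

theorem mollify_eq_convolution_left {n : ℕ} (φ : ContDiffBump (0 : Euc n)) (u : Euc n → ℝ) :
    mollify φ u = convolution (φ.normed volume) u (ContinuousLinearMap.lsmul ℝ ℝ) volume := by
  ext x
  rw [convolution_lsmul_swap]
  exact integral_congr_ae (Eventually.of_forall fun t => by simp [mul_comm])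

theorem integrable_mollify {n : ℕ} (φ : ContDiffBump (0 : Euc n)) {u : Euc n → ℝ}
    (hu : Integrable u) : Integrable (mollify φ u) := by
  rw [mollify_eq_convolution_right]
  exact hu.integrable_convolution _ φ.integrable_normed

theorem integral_mollify {n : ℕ} (φ : ContDiffBump (0 : Euc n)) {u : Euc n → ℝ}
    (hu : Integrable u) : ∫ x, mollify φ u x = ∫ x, u x := by
  rw [mollify_eq_convolution_right, integral_convolution _ hu φ.integrable_normed]
  simp [φ.integral_normed]

theorem mollify_sub {n : ℕ} (φ : ContDiffBump (0 : Euc n)) {u v : Euc n → ℝ}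
    (hu : Integrable u) (hv : Integrable v) (x : Euc n) :
    mollify φ (fun y => u y - v y) x = mollify φ u x - mollify φ v x := by
  have hi : ∀ f : Euc n → ℝ, Integrable f →
      Integrable (fun t => f t * φ.normed volume (x - t)) := fun f hf =>
    φ.hasCompactSupport_normed.convolutionExists_right (ContinuousLinearMap.mul ℝ ℝ)
      hf.locallyIntegrable φ.continuous_normed x
  simp only [mollify]
  rw [← integral_sub (hi u hu) (hi v hv)]
  simp_rw [sub_mul]

theorem contDiff_mollify {n : ℕ} (φ : ContDiffBump (0 : Euc n)) {u : Euc n → ℝ}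
    (hu : Integrable u) : ContDiff ℝ 1 (mollify φ u) := by
  rw [mollify_eq_convolution_right]
  exact_mod_cast φ.hasCompactSupport_normed.contDiff_convolution_right (n := 1)
    (ContinuousLinearMap.mul ℝ ℝ) hu.locallyIntegrable φ.contDiff_normed

theorem fderiv_mollify {n : ℕ} (φ : ContDiffBump (0 : Euc n)) {u : Euc n → ℝ}
    (hu : Integrable u) (x e : Euc n) :
    fderiv ℝ (mollify φ u) x e = ∫ t, u t * fderiv ℝ (φ.normed volume) (x - t) e := by
  rw [mollify_eq_convolution_right,
    (φ.hasCompactSupport_normed.hasFDerivAt_convolution_right (ContinuousLinearMap.mul ℝ ℝ)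
      hu.locallyIntegrable (φ.contDiff_normed (n := 1)) x).fderiv,
    convolution_precompR_apply _ hu.locallyIntegrable (φ.hasCompactSupport_normed.fderiv ℝ)
      ((φ.contDiff_normed (n := 1)).continuous_fderiv one_ne_zero)]
  rfl

theorem ae_tendsto_mollify {n : ℕ} {φ : ℕ → ContDiffBump (0 : Euc n)} {K : ℝ}
    (hφ : Tendsto (fun k => (φ k).rOut) atTop (𝓝 0)) (hK : ∀ k, (φ k).rOut ≤ K * (φ k).rIn)
    {u : Euc n → ℝ} (hu : Integrable u) :
    ∀ᵐ x, Tendsto (fun k => mollify (φ k) u x) atTop (𝓝 (u x)) := by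
  simp_rw [mollify_eq_convolution_left]
  exact ContDiffBump.ae_convolution_tendsto_right_of_locallyIntegrable hφ
    (Eventually.of_forall hK) hu.locallyIntegrable

theorem tendsto_integral_abs_mollify_sub {n : ℕ} {φ : ℕ → ContDiffBump (0 : Euc n)} {K : ℝ}
    (hφ : Tendsto (fun k => (φ k).rOut) atTop (𝓝 0)) (hK : ∀ k, (φ k).rOut ≤ K * (φ k).rIn)
    {u : Euc n → ℝ} (hu : Integrable u) :
    Tendsto (fun k => ∫ x, |mollify (φ k) u x - u x|) atTop (𝓝 0) := by
  have hpos : ∀ v : Euc n → ℝ, Integrable v → (∀ x, 0 ≤ v x) →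
      Tendsto (fun k => ∫ x, |mollify (φ k) v x - v x|) atTop (𝓝 0) := by
    intro v hv hv0
    refine tendsto_integral_abs_sub_of_nonneg (fun k => integrable_mollify (φ k) hv) hv ?_ hv0
      (fun k => integral_mollify (φ k) hv) (ae_tendsto_mollify hφ hK hv)
    exact fun k x => integral_nonneg fun t => mul_nonneg (hv0 t) ((φ k).nonneg_normed _)
  have hp := hu.pos_part
  have hm := hu.neg_part
  have hsum := (hpos _ hp fun x => le_max_right _ _).add (hpos _ hm fun x => le_max_right _ _)
  rw [add_zero] at hsum
  refine squeeze_zero (fun k => integral_nonneg fun x => abs_nonneg _) (fun k => ?_) hsum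
  have ip := ((integrable_mollify (φ k) hp).sub hp).abs
  have im := ((integrable_mollify (φ k) hm).sub hm).abs
  refine (integral_mono ((integrable_mollify (φ k) hu).sub hu).abs (ip.add im) fun x => ?_).trans_eq
    (integral_add ip im)
  have hdec : u = fun y => max (u y) 0 - max (-u y) 0 := by
    ext y
    rcases le_total (u y) 0 with hy | hy
    · rw [max_eq_right hy, max_eq_left (by linarith)]; ring
    · rw [max_eq_left hy, max_eq_right (by linarith)]; ring
  have hmol : mollify (φ k) u x
      = mollify (φ k) (fun y => max (u y) 0) x - mollify (φ k) (fun y => max (-u y) 0) x := by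
    rw [← mollify_sub (φ k) hp hm, ← hdec]
  have hux := congrFun hdec x
  simp only [Pi.sub_apply, Pi.add_apply] at hux ⊢
  rw [hmol]
  nth_rewrite 1 [hux]
  rw [sub_sub_sub_comm]
  exact abs_sub _ _

theorem fderiv_mollify_indicator {n : ℕ} {D K : Set (Euc n)} {f g : Euc n → ℝ} {i : Fin n}
    (hfg : IsWeakPartialDeriv D f g i) (hKD : K ⊆ D) (hf : Integrable (K.indicator f))
    (φ : ContDiffBump (0 : Euc n)) {x : Euc n} (hx : closedBall x φ.rOut ⊆ K) :
    fderiv ℝ (mollify φ (K.indicator f)) x (EuclideanSpace.single i 1)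
      = mollify φ (K.indicator g) x := by
  set ψ : Euc n → ℝ := fun t => φ.normed volume (x - t) with hψ
  set e : Euc n := EuclideanSpace.single i 1
  have hψd : ContDiff ℝ (⊤ : ℕ∞) ψ := φ.contDiff_normed.comp (contDiff_const.sub contDiff_id)
  have hφd : Differentiable ℝ (φ.normed (volume : Measure (Euc n))) :=
    (φ.contDiff_normed (n := 1)).differentiable one_ne_zero
  have hzero : ∀ t ∉ closedBall x φ.rOut, ψ t = 0 := by
    intro t ht
    by_contra h
    have : x - t ∈ Function.support (φ.normed (volume : Measure (Euc n))) := h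
    rw [φ.support_normed_eq, mem_ball_zero_iff, ← dist_eq_norm, dist_comm] at this
    exact ht this.le
  have hts : tsupport ψ ⊆ closedBall x φ.rOut :=
    closure_minimal (fun t ht => by_contra fun h => ht (hzero t h)) isClosed_closedBall
  have hψc : HasCompactSupport ψ :=
    (isCompact_closedBall x φ.rOut).of_isClosed_subset (isClosed_tsupport _) hts
  have hψ' : ∀ t, fderiv ℝ ψ t e = - fderiv ℝ (φ.normed volume) (x - t) e := by
    intro t
    have h1 : HasFDerivAt (fun s : Euc n => x - s) (-ContinuousLinearMap.id ℝ (Euc n)) t :=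
      (hasFDerivAt_id t).const_sub x
    have h2 := (hφd (x - t)).hasFDerivAt.comp t h1
    rw [show ψ = φ.normed volume ∘ fun s => x - s from rfl, h2.fderiv]
    simp
  have hKK : ∀ h : Euc n → ℝ, ∀ t, t ∈ closedBall x φ.rOut → K.indicator h t = h t :=
    fun h t ht => indicator_of_mem (hx ht) h
  have key := hfg ψ hψd hψc (hts.trans (hx.trans hKD))
  have e1 : ∫ t in D, f t * fderiv ℝ ψ t e = ∫ t, K.indicator f t * fderiv ℝ ψ t e := by
    have hz : ∀ t ∉ closedBall x φ.rOut, fderiv ℝ ψ t e = 0 := fun t ht => by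
      rw [fderiv_of_notMem_tsupport ℝ (fun h => ht (hts h))]; rfl
    rw [setIntegral_eq_integral_of_forall_compl_eq_zero fun t ht => by
      rw [hz t fun h => ht (hKD (hx h)), mul_zero]]
    refine integral_congr_ae (Eventually.of_forall fun t => ?_)
    by_cases ht : t ∈ closedBall x φ.rOut
    · simp only [hKK f t ht]
    · simp only [hz t ht, mul_zero]
  have e2 : ∫ t in D, g t * ψ t = ∫ t, K.indicator g t * ψ t := by
    rw [setIntegral_eq_integral_of_forall_compl_eq_zero fun t ht => by
      rw [hzero t fun h => ht (hKD (hx h)), mul_zero]]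
    refine integral_congr_ae (Eventually.of_forall fun t => ?_)
    by_cases ht : t ∈ closedBall x φ.rOut
    · simp only [hKK g t ht]
    · simp only [hzero t ht, mul_zero]
  rw [e1, e2] at key
  rw [fderiv_mollify φ hf]
  simp only [hψ', mul_neg, integral_neg, neg_inj] at key
  exact key

/-- The weak derivative chain rule for `C¹` functions with bounded derivative. -/
theorem IsWeakPartialDeriv.comp {n : ℕ} {D : Set (Euc n)} (hD : IsOpen D) {f g : Euc n → ℝ}
    {i : Fin n} (hf : LocallyIntegrableOn f D) (hg : LocallyIntegrableOn g D)
    (hfg : IsWeakPartialDeriv D f g i) {Φ m : ℝ → ℝ} (hΦ : ∀ t, HasDerivAt Φ (m t) t)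
    (hm : Continuous m) {L : ℝ} (hL : ∀ t, |m t| ≤ L) (hΦ0 : Φ 0 = 0) :
    IsWeakPartialDeriv D (fun x => Φ (f x)) (fun x => m (f x) * g x) i := by
  intro η hη hηc hηD
  set e : Euc n := EuclideanSpace.single i 1
  obtain ⟨δ, hδ, hδD⟩ := hηc.isCompact.exists_cthickening_subset_open hD hηD
  set K := cthickening δ (tsupport η) with hK
  have hKc : IsCompact K := hηc.isCompact.cthickening
  have hKm : MeasurableSet K := hKc.measurableSet
  have hηK : tsupport η ⊆ K := self_subset_cthickening _
  set u := K.indicator f with hu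
  set v := K.indicator g with hv
  have hui : Integrable u :=
    (integrable_indicator_iff hKm).2 (hf.integrableOn_compact_subset hδD hKc)
  have hvi : Integrable v :=
    (integrable_indicator_iff hKm).2 (hg.integrableOn_compact_subset hδD hKc)
  let φ : ℕ → ContDiffBump (0 : Euc n) := fun k =>
    ⟨δ / (k + 1) / 2, δ / (k + 1), by positivity, half_lt_self (by positivity)⟩
  have hφ0 : Tendsto (fun k => (φ k).rOut) atTop (𝓝 0) := by
    simpa [φ, div_eq_mul_inv] using
      (tendsto_one_div_add_atTop_nhds_zero_nat (𝕜 := ℝ)).const_mul δ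
  have hφK : ∀ k, (φ k).rOut ≤ 2 * (φ k).rIn := fun k => by simp only [φ]; linarith
  have hφδ : ∀ k, (φ k).rOut ≤ δ := fun k =>
    div_le_self hδ.le (by linarith [k.cast_nonneg (α := ℝ)])
  have hLip : ∀ s t, |Φ s - Φ t| ≤ L * |s - t| := fun s t =>
    Convex.norm_image_sub_le_of_norm_hasDerivWithin_le (s := univ) (f := Φ) (f' := m)
      (fun x _ => (hΦ x).hasDerivWithinAt) (fun x _ => hL x) convex_univ (mem_univ t) (mem_univ s)
  have hL0 : 0 ≤ L := (abs_nonneg _).trans (hL 0)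
  have hΦc : Continuous Φ := continuous_iff_continuousAt.2 fun t => (hΦ t).continuousAt
  have hΦle : ∀ t, |Φ t| ≤ L * |t| := fun t => by simpa [hΦ0] using hLip t 0
  have hΦi : ∀ h : Euc n → ℝ, Integrable h → Integrable fun x => Φ (h x) := fun h hh =>
    (hh.abs.const_mul L).mono' (hΦc.comp_aestronglyMeasurable hh.aestronglyMeasurable)
      (Eventually.of_forall fun x => hΦle _)
  have hη1 : ContDiff ℝ 1 η := hη.of_le (by exact_mod_cast le_top)
  have hdηc : Continuous fun x => fderiv ℝ η x e :=
    (hη1.continuous_fderiv one_ne_zero).clm_apply continuous_const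
  obtain ⟨B, hB⟩ := hηc.exists_bound_of_continuous hη1.continuous
  obtain ⟨B', hB'⟩ := (hηc.fderiv_apply (𝕜 := ℝ) e).exists_bound_of_continuous hdηc
  have hB0 : 0 ≤ B := (norm_nonneg _).trans (hB 0)
  have hmη : ∀ {a b : Euc n → ℝ}, AEStronglyMeasurable a → Integrable b →
      Integrable fun x => m (a x) * b x * η x := by
    intro a b ha hb
    exact (hb.bdd_mul (c := L) (hm.comp_aestronglyMeasurable ha)
      (Eventually.of_forall fun x => hL _)).mul_bdd
      (c := B) hη1.continuous.aestronglyMeasurable (Eventually.of_forall hB)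
  have hΦη : ∀ {a : Euc n → ℝ}, Integrable a → Integrable fun x => Φ (a x) * fderiv ℝ η x e :=
    fun ha => (hΦi _ ha).mul_bdd (c := B') hdηc.aestronglyMeasurable (Eventually.of_forall hB')
  have hibp : ∀ k, ∫ x, Φ (mollify (φ k) u x) * fderiv ℝ η x e
      = - ∫ x, m (mollify (φ k) u x) * mollify (φ k) v x * η x := by
    intro k
    have hmd : Differentiable ℝ (mollify (φ k) u) :=
      (contDiff_mollify (φ k) hui).differentiable one_ne_zero
    have hcomp : ∀ x, HasFDerivAt (fun y => Φ (mollify (φ k) u y))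
        (m (mollify (φ k) u x) • fderiv ℝ (mollify (φ k) u) x) x := fun x =>
      (hΦ _).comp_hasFDerivAt x (hmd x).hasFDerivAt
    have hd : ∀ x, fderiv ℝ (fun y => Φ (mollify (φ k) u y)) x e * η x
        = m (mollify (φ k) u x) * mollify (φ k) v x * η x := by
      intro x
      by_cases hx : x ∈ tsupport η
      · rw [(hcomp x).fderiv, ← fderiv_mollify_indicator hfg hδD hui (φ k)
          ((closedBall_subset_closedBall (hφδ k)).trans
            (closedBall_subset_cthickening hx δ))]
        rfl
      · rw [image_eq_zero_of_notMem_tsupport hx, mul_zero, mul_zero]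
    rw [integral_mul_fderiv_eq_neg_fderiv_mul_of_integrable]
    · simp_rw [hd]
    · simp_rw [hd]
      exact hmη (integrable_mollify (φ k) hui).aestronglyMeasurable (integrable_mollify (φ k) hvi)
    · exact hΦη (integrable_mollify (φ k) hui)
    · exact (hΦi _ (integrable_mollify (φ k) hui)).mul_bdd (c := B)
        hη1.continuous.aestronglyMeasurable (Eventually.of_forall hB)
    · exact fun x _ => (hcomp x).differentiableAt
    · exact fun x _ => hη1.differentiable one_ne_zero x
  have hlim1 : Tendsto (fun k => ∫ x, Φ (mollify (φ k) u x) * fderiv ℝ η x e) atTop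
      (𝓝 (∫ x, Φ (u x) * fderiv ℝ η x e)) := by
    have h0 := (tendsto_integral_abs_mollify_sub hφ0 hφK hui).const_mul (L * B')
    rw [mul_zero] at h0
    refine tendsto_iff_norm_sub_tendsto_zero.2 (squeeze_zero (fun _ => norm_nonneg _)
      (fun k => ?_) h0)
    rw [← integral_sub (hΦη (integrable_mollify (φ k) hui)) (hΦη hui), ← integral_const_mul]
    refine norm_integral_le_of_norm_le
      (((integrable_mollify (φ k) hui).sub hui).abs.const_mul _) (Eventually.of_forall fun x => ?_)
    rw [← sub_mul, norm_mul]
    calc _ ≤ L * |mollify (φ k) u x - u x| * B' :=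
          mul_le_mul (hLip _ _) (hB' x) (norm_nonneg _) (by positivity)
      _ = _ := by ring
  have hlim2 : Tendsto (fun k => ∫ x, m (mollify (φ k) u x) * mollify (φ k) v x * η x) atTop
      (𝓝 (∫ x, m (u x) * v x * η x)) := by
    have hfirst : Tendsto (fun k => ∫ x, m (mollify (φ k) u x) * (mollify (φ k) v x - v x) * η x)
        atTop (𝓝 0) := by
      have h0 := (tendsto_integral_abs_mollify_sub hφ0 hφK hvi).const_mul (L * B)
      rw [mul_zero] at h0
      refine squeeze_zero_norm (fun k => ?_) h0
      rw [← integral_const_mul]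
      refine norm_integral_le_of_norm_le
        (((integrable_mollify (φ k) hvi).sub hvi).abs.const_mul _)
        (Eventually.of_forall fun x => ?_)
      rw [norm_mul, norm_mul]
      calc _ ≤ L * |mollify (φ k) v x - v x| * B :=
            mul_le_mul (mul_le_mul_of_nonneg_right (hL _) (abs_nonneg _)) (hB x)
              (norm_nonneg _) (by positivity)
        _ = _ := by ring
    have hsecond : Tendsto (fun k => ∫ x, m (mollify (φ k) u x) * v x * η x) atTop
        (𝓝 (∫ x, m (u x) * v x * η x)) := by
      refine tendsto_integral_of_dominated_convergence (fun x => L * |v x| * B) (fun k => ?_)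
        ((hvi.abs.const_mul L).mul_const B) (fun k => Eventually.of_forall fun x => ?_) ?_
      · exact (hmη (integrable_mollify (φ k) hui).aestronglyMeasurable hvi).aestronglyMeasurable
      · rw [norm_mul, norm_mul]
        exact mul_le_mul (mul_le_mul_of_nonneg_right (hL _) (abs_nonneg _)) (hB x)
          (norm_nonneg _) (by positivity)
      · filter_upwards [ae_tendsto_mollify hφ0 hφK hui] with x hx
        exact (((hm.tendsto _).comp hx).mul_const _).mul_const _
    have := hfirst.add hsecond
    rw [zero_add] at this
    refine this.congr fun k => ?_
    have hk := (integrable_mollify (φ k) hui).aestronglyMeasurable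
    refine (integral_add (hmη hk ((integrable_mollify (φ k) hvi).sub hvi)) (hmη hk hvi)).symm.trans
      (integral_congr_ae (Eventually.of_forall fun x => ?_))
    simp only [Pi.sub_apply]
    ring
  have hfin : ∫ x, Φ (u x) * fderiv ℝ η x e = - ∫ x, m (u x) * v x * η x :=
    tendsto_nhds_unique hlim1 ((hlim2.neg).congr fun k => (hibp k).symm)
  have hz : ∀ x ∉ tsupport η, fderiv ℝ η x e = 0 := fun x hx => by
    rw [fderiv_of_notMem_tsupport ℝ hx]; rfl
  rw [setIntegral_eq_integral_of_forall_compl_eq_zero fun x hx => by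
      rw [hz x fun h => hx (hηD h), mul_zero],
    setIntegral_eq_integral_of_forall_compl_eq_zero fun x hx => by
      rw [image_eq_zero_of_notMem_tsupport fun h => hx (hηD h), mul_zero]]
  refine (integral_congr_ae (Eventually.of_forall fun x => ?_)).trans
    (hfin.trans (congrArg Neg.neg (integral_congr_ae (Eventually.of_forall fun x => ?_))))
  · by_cases hx : x ∈ tsupport η
    · simp only [hu, indicator_of_mem (hηK hx)]
    · simp only [hz x hx, mul_zero]
  · by_cases hx : x ∈ tsupport η
    · simp only [hu, hv, indicator_of_mem (hηK hx)]
    · simp only [image_eq_zero_of_notMem_tsupport hx, mul_zero]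

theorem integrableOn_mul_of_tsupport_subset {n : ℕ} {D : Set (Euc n)} {f h : Euc n → ℝ}
    (hf : LocallyIntegrableOn f D) (hh : Continuous h) (hhc : HasCompactSupport h)
    (hhD : tsupport h ⊆ D) : IntegrableOn (fun x => f x * h x) D := by
  obtain ⟨B, hB⟩ := hhc.exists_bound_of_continuous hh
  have h1 : IntegrableOn (fun x => f x * h x) (tsupport h) :=
    (hf.integrableOn_compact_subset hhD hhc.isCompact).mul_bdd (c := B) hh.aestronglyMeasurable
      (Eventually.of_forall hB)
  have h2 : Function.support (fun x => f x * h x) ⊆ tsupport h := fun x hx =>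
    subset_tsupport h (right_ne_zero_of_mul hx)
  exact ((integrableOn_iff_integrable_of_support_subset h2).1 h1).integrableOn

/-- A function that is a weak derivative in the sense of Bochner integrals is either locally
integrable, or the zero function is a weak derivative as well. -/
theorem IsWeakPartialDeriv.locallyIntegrableOn_or_zero {n : ℕ} {D : Set (Euc n)} (hD : IsOpen D)
    {f g : Euc n → ℝ} {i : Fin n} (hf : LocallyIntegrableOn f D)
    (hfg : IsWeakPartialDeriv D f g i) :
    LocallyIntegrableOn g D ∨ IsWeakPartialDeriv D f (fun _ => 0) i := by
  by_cases H : ∀ η : Euc n → ℝ, ContDiff ℝ (⊤ : ℕ∞) η → HasCompactSupport η → tsupport η ⊆ D →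
      IntegrableOn (fun x => g x * η x) D
  · left
    intro x hx
    obtain ⟨r, hr, hrD⟩ := nhds_basis_closedBall.mem_iff.1 (hD.mem_nhds hx)
    let φ : ContDiffBump x := ⟨r / 2, r, by positivity, half_lt_self hr⟩
    have hφ := H φ φ.contDiff φ.hasCompactSupport (by rwa [φ.tsupport_eq])
    refine ⟨closedBall x (r / 2), mem_nhdsWithin_of_mem_nhds (closedBall_mem_nhds x (by positivity)),
      ?_⟩
    refine (hφ.mono_set ((closedBall_subset_closedBall (half_le_self hr.le)).trans hrD)).congr_fun
      (fun y hy => ?_) measurableSet_closedBall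
    simp only [φ.one_of_mem_closedBall hy, mul_one]
  · right
    push Not at H
    obtain ⟨η₀, h1, h2, h3, h4⟩ := H
    have hdi : ∀ η : Euc n → ℝ, ContDiff ℝ (⊤ : ℕ∞) η → HasCompactSupport η → tsupport η ⊆ D →
        IntegrableOn (fun x => f x * fderiv ℝ η x (EuclideanSpace.single i 1)) D := by
      intro η hη hηc hηD
      refine integrableOn_mul_of_tsupport_subset hf ?_ (hηc.fderiv_apply (𝕜 := ℝ) _)
        ((tsupport_fderiv_apply_subset ℝ _).trans hηD)
      exact (hη.continuous_fderiv (by simp)).clm_apply continuous_const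
    intro η hη hηc hηD
    simp only [zero_mul, integral_zero, neg_zero]
    by_cases hi : IntegrableOn (fun x => g x * η x) D
    · have hsum : ¬ IntegrableOn (fun x => g x * (η₀ x + η x)) D := fun h => h4 <| by
        refine (h.sub hi).congr (Eventually.of_forall fun x => ?_)
        simp only [Pi.sub_apply]
        ring
      have e0 := hfg η₀ h1 h2 h3
      rw [integral_undef h4, neg_zero] at e0
      have e1 := hfg (fun x => η₀ x + η x) (h1.add hη) (h2.add hηc)
        ((tsupport_add η₀ η).trans (union_subset h3 hηD))
      rw [integral_undef hsum, neg_zero] at e1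
      have hd : ∀ x, fderiv ℝ (fun x => η₀ x + η x) x (EuclideanSpace.single i 1)
          = fderiv ℝ η₀ x (EuclideanSpace.single i 1)
            + fderiv ℝ η x (EuclideanSpace.single i 1) := by
        intro x
        rw [fderiv_fun_add (h1.differentiable (by simp) x) (hη.differentiable (by simp) x)]
        rfl
      simp_rw [hd, mul_add] at e1
      rwa [integral_add (hdi η₀ h1 h2 h3) (hdi η hη hηc hηD), e0, zero_add] at e1
    · rw [hfg η hη hηc hηD, integral_undef hi, neg_zero]

theorem IsWeakGradient.exists_locallyIntegrableOn {n : ℕ} {D : Set (Euc n)} (hD : IsOpen D)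
    {f : Euc n → ℝ} {G : Euc n → Euc n} (hf : LocallyIntegrableOn f D)
    (hG : IsWeakGradient D f G) :
    ∃ G' : Euc n → Euc n, IsWeakGradient D f G' ∧
      (∀ i, LocallyIntegrableOn (fun x => G' x i) D) ∧ ∀ x, ‖G' x‖ ≤ ‖G x‖ := by
  classical
  refine ⟨fun x => WithLp.toLp 2 fun i =>
    if LocallyIntegrableOn (fun x => G x i) D then G x i else 0, fun i => ?_, fun i => ?_,
    fun x => ?_⟩
  · by_cases h : LocallyIntegrableOn (fun x => G x i) D
    · simpa only [if_pos h] using hG i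
    · simpa only [if_neg h] using ((hG i).locallyIntegrableOn_or_zero hD hf).resolve_left h
  · by_cases h : LocallyIntegrableOn (fun x => G x i) D
    · simpa only [if_pos h] using h
    · simpa only [if_neg h] using (locallyIntegrable_zero (μ := volume)).locallyIntegrableOn D
  · simp only [EuclideanSpace.norm_eq]
    refine Real.sqrt_le_sqrt (Finset.sum_le_sum fun i _ => ?_)
    split_ifs
    · exact le_rfl
    · simpa using sq_nonneg (G x i)

/-- A bounded continuous truncation of `|t| ^ a`, dominated by a multiple of `|t| ^ b`. -/
def truncPow (a b N t : ℝ) : ℝ := min (|t| ^ a) (min (N * |t| ^ b) N)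

section truncPow

variable {a b N : ℝ}

theorem continuous_truncPow (ha : 0 < a) (hb : 0 < b) : Continuous (truncPow a b N) :=
  (continuous_abs.rpow_const fun _ => Or.inr ha.le).min
    ((continuous_const.mul (continuous_abs.rpow_const fun _ => Or.inr hb.le)).min continuous_const)

theorem truncPow_nonneg (hN : 0 ≤ N) (t : ℝ) : 0 ≤ truncPow a b N t := by
  unfold truncPow; positivity

theorem truncPow_neg (t : ℝ) : truncPow a b N (-t) = truncPow a b N t := by
  simp [truncPow]

theorem truncPow_abs (t : ℝ) : truncPow a b N |t| = truncPow a b N t := by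
  simp [truncPow]

theorem truncPow_le_rpow_left (t : ℝ) : truncPow a b N t ≤ |t| ^ a := min_le_left _ _

theorem truncPow_le_rpow_right (t : ℝ) : truncPow a b N t ≤ N * |t| ^ b :=
  (min_le_right _ _).trans (min_le_left _ _)

theorem truncPow_le_const (t : ℝ) : truncPow a b N t ≤ N :=
  (min_le_right _ _).trans (min_le_right _ _)

theorem truncPow_mono (ha : 0 < a) (hb : 0 < b) (hN : 0 ≤ N) {s t : ℝ} (hst : |s| ≤ |t|) :
    truncPow a b N s ≤ truncPow a b N t := by
  unfold truncPow
  gcongr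

theorem truncPow_half_ge (ha : 0 < a) (hb : 0 < b) (hN : 0 ≤ N) (t : ℝ) :
    (1 / 2) ^ (a + b) * truncPow a b N t ≤ truncPow a b N (t / 2) := by
  have hc : ∀ c : ℝ, |t / 2| ^ c = (1 / 2) ^ c * |t| ^ c := fun c => by
    rw [← Real.mul_rpow (by norm_num) (abs_nonneg t), abs_div, abs_two]
    congr 1; ring
  have hca : (1 / 2 : ℝ) ^ (a + b) ≤ (1 / 2) ^ a :=
    Real.rpow_le_rpow_of_exponent_ge (by norm_num) (by norm_num) (by linarith)
  have hcb : (1 / 2 : ℝ) ^ (a + b) ≤ (1 / 2) ^ b :=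
    Real.rpow_le_rpow_of_exponent_ge (by norm_num) (by norm_num) (by linarith)
  have hc1 : (1 / 2 : ℝ) ^ (a + b) ≤ 1 :=
    Real.rpow_le_one (by norm_num) (by norm_num) (by linarith)
  have h0 := truncPow_nonneg (a := a) (b := b) hN t
  refine le_min ?_ (le_min ?_ ?_)
  · rw [hc]
    exact mul_le_mul hca (truncPow_le_rpow_left t) h0 (by positivity)
  · rw [hc, mul_left_comm]
    exact mul_le_mul hcb (truncPow_le_rpow_right t) h0 (by positivity)
  · exact (mul_le_of_le_one_left h0 hc1).trans (truncPow_le_const t)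

theorem tendsto_truncPow (ha : 0 < a) (t : ℝ) :
    Tendsto (fun N : ℕ => truncPow a b N t) atTop (𝓝 (|t| ^ a)) := by
  rcases eq_or_ne t 0 with rfl | ht
  · refine tendsto_const_nhds.congr fun N => ?_
    simp only [truncPow, abs_zero, Real.zero_rpow ha.ne']
    symm
    exact min_eq_left (by positivity)
  · refine tendsto_const_nhds.congr' ?_
    have hb0 : 0 < |t| ^ b := Real.rpow_pos_of_pos (abs_pos.2 ht) b
    obtain ⟨N₀, hN₀⟩ := exists_nat_ge (max (|t| ^ a) (|t| ^ a / |t| ^ b))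
    filter_upwards [eventually_ge_atTop N₀] with N hN
    have hN' : max (|t| ^ a) (|t| ^ a / |t| ^ b) ≤ N := hN₀.trans (by exact_mod_cast hN)
    symm
    refine min_eq_left (le_min ?_ ((le_max_left _ _).trans hN'))
    exact (div_le_iff₀ hb0).1 ((le_max_right _ _).trans hN')

/-- The odd primitive of `truncPow`. -/
def truncPowPrim (a b N t : ℝ) : ℝ := ∫ s in (0 : ℝ)..t, truncPow a b N s

theorem hasDerivAt_truncPowPrim (ha : 0 < a) (hb : 0 < b) (t : ℝ) :
    HasDerivAt (truncPowPrim a b N) (truncPow a b N t) t :=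
  ((continuous_truncPow ha hb).integral_hasStrictDerivAt 0 t).hasDerivAt

theorem truncPowPrim_neg (t : ℝ) : truncPowPrim a b N (-t) = -truncPowPrim a b N t := by
  unfold truncPowPrim
  rw [← intervalIntegral.integral_symm]
  have := intervalIntegral.integral_comp_neg (a := t) (b := 0) (truncPow a b N)
  simp only [truncPow_neg, neg_zero] at this
  exact this.symm

theorem abs_truncPowPrim (hN : 0 ≤ N) (t : ℝ) :
    |truncPowPrim a b N t| = truncPowPrim a b N |t| := by
  have h0 : ∀ s, 0 ≤ s → 0 ≤ truncPowPrim a b N s := fun s hs =>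
    intervalIntegral.integral_nonneg hs fun x _ => truncPow_nonneg hN x
  rcases le_total 0 t with ht | ht
  · rw [abs_of_nonneg ht, abs_of_nonneg (h0 t ht)]
  · rw [abs_of_nonpos ht, ← abs_neg (truncPowPrim a b N t), ← truncPowPrim_neg,
      abs_of_nonneg (h0 _ (by linarith))]

theorem abs_truncPowPrim_le (ha : 0 < a) (hb : 0 < b) (hN : 0 ≤ N) (t : ℝ) :
    |truncPowPrim a b N t| ≤ |t| * truncPow a b N t := by
  rw [abs_truncPowPrim hN, ← truncPow_abs t]
  have := intervalIntegral.integral_mono_on (μ := volume) (abs_nonneg t)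
    ((continuous_truncPow (N := N) ha hb).intervalIntegrable 0 |t|)
    (intervalIntegrable_const (c := truncPow a b N |t|)) fun s hs =>
      truncPow_mono ha hb hN (by rw [abs_abs, abs_of_nonneg hs.1]; exact hs.2)
  simpa [truncPowPrim] using this

theorem abs_mul_truncPow_le (ha : 0 < a) (hb : 0 < b) (hN : 0 ≤ N) (t : ℝ) :
    |t| * truncPow a b N t ≤ 2 ^ (a + b + 1) * |truncPowPrim a b N t| := by
  have hi : ∀ s r, IntervalIntegrable (truncPow a b N) volume s r := fun s r =>
    (continuous_truncPow ha hb).intervalIntegrable s r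
  have hlow : |t| / 2 * truncPow a b N (|t| / 2) ≤ |truncPowPrim a b N t| := by
    rw [abs_truncPowPrim hN]
    have h1 := intervalIntegral.integral_mono_on (μ := volume) (half_le_self (abs_nonneg t))
      (intervalIntegrable_const (c := truncPow a b N (|t| / 2))) (hi (|t| / 2) |t|) fun s hs =>
        truncPow_mono ha hb hN (by
          have h0 : 0 ≤ |t| / 2 := by positivity
          rw [abs_of_nonneg h0, abs_of_nonneg (h0.trans hs.1)]; exact hs.1)
    have h2 : 0 ≤ ∫ s in (0 : ℝ)..(|t| / 2), truncPow a b N s :=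
      intervalIntegral.integral_nonneg (by positivity) fun x _ => truncPow_nonneg hN x
    rw [intervalIntegral.integral_const, smul_eq_mul, sub_half] at h1
    rw [truncPowPrim, ← intervalIntegral.integral_add_adjacent_intervals (hi 0 (|t| / 2)) (hi _ _)]
    linarith
  have h3 := truncPow_half_ge ha hb hN |t|
  rw [truncPow_abs] at h3
  have h4 : (2 : ℝ) ^ (a + b + 1) * ((1 / 2) ^ (a + b)) = 2 := by
    rw [Real.rpow_add_one two_ne_zero, mul_right_comm, ← Real.mul_rpow (by norm_num) (by norm_num)]
    norm_num
  calc |t| * truncPow a b N t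
      = 2 ^ (a + b + 1) * (|t| / 2 * ((1 / 2) ^ (a + b) * truncPow a b N t)) := by
        linear_combination (-(|t| / 2 * truncPow a b N t)) * h4
    _ ≤ 2 ^ (a + b + 1) * (|t| / 2 * truncPow a b N (|t| / 2)) := by gcongr
    _ ≤ _ := by gcongr

end truncPow

/-- Hölder's inequality for powers, in terms of Bochner integrals. -/
theorem integral_mul_rpow_le {α : Type*} [MeasurableSpace α] {μ : Measure α} {M F : α → ℝ}
    (hM : AEStronglyMeasurable M μ) (hF : AEStronglyMeasurable F μ) (hM0 : ∀ x, 0 ≤ M x)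
    (hF0 : ∀ x, 0 ≤ F x) {r p s : ℝ} (hr : 0 < r) (hp : 0 < p) (hs : 0 < s)
    (hrps : 1 / r + 1 / p = 1 / s) (hMi : Integrable (fun x => M x ^ r) μ)
    (hFi : Integrable (fun x => F x ^ p) μ) :
    Integrable (fun x => (M x * F x) ^ s) μ ∧
      (∫ x, (M x * F x) ^ s ∂μ) ^ (1 / s)
        ≤ (∫ x, M x ^ r ∂μ) ^ (1 / r) * (∫ x, F x ^ p ∂μ) ^ (1 / p) := by
  have hconj : (r / s).HolderConjugate (p / s) := by
    rw [Real.holderConjugate_iff]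
    constructor
    · rw [lt_div_iff₀ hs, one_mul]
      by_contra! h
      have h1 : 1 / s ≤ 1 / r := one_div_le_one_div_of_le hr h
      have h2 : 0 < 1 / p := by positivity
      linarith
    · rw [inv_div, inv_div]
      calc s / r + s / p = s * (1 / r + 1 / p) := by ring
        _ = 1 := by rw [hrps]; field_simp
  have hpow : ∀ {H : α → ℝ} {c : ℝ}, (∀ x, 0 ≤ H x) →
      (fun x => (H x ^ s) ^ (c / s)) = fun x => H x ^ c := fun hH => by
    ext x
    rw [← Real.rpow_mul (hH x), mul_div_cancel₀ _ hs.ne']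
  have hmem : ∀ {H : α → ℝ} {c : ℝ}, 0 < c → AEStronglyMeasurable H μ → (∀ x, 0 ≤ H x) →
      Integrable (fun x => H x ^ c) μ →
      MemLp (fun x => H x ^ s) (ENNReal.ofReal (c / s)) μ := by
    intro H c hc hHm hH hHi
    have hcs : 0 < c / s := by positivity
    rw [← integrable_norm_rpow_iff (hHm.aemeasurable.pow_const s).aestronglyMeasurable
      (by simpa using hcs) ENNReal.ofReal_ne_top, ENNReal.toReal_ofReal hcs.le]
    simp_rw [Real.norm_of_nonneg (Real.rpow_nonneg (hH _) s)]
    rwa [hpow hH]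
  have hMs := hmem hr hM hM0 hMi
  have hFs := hmem hp hF hF0 hFi
  have hmul : ∀ x, (M x * F x) ^ s = M x ^ s * F x ^ s := fun x =>
    Real.mul_rpow (hM0 x) (hF0 x)
  have hIM : 0 ≤ ∫ x, M x ^ r ∂μ := integral_nonneg fun x => Real.rpow_nonneg (hM0 x) r
  have hIF : 0 ≤ ∫ x, F x ^ p ∂μ := integral_nonneg fun x => Real.rpow_nonneg (hF0 x) p
  have : ENNReal.HolderConjugate (ENNReal.ofReal (r / s)) (ENNReal.ofReal (p / s)) :=
    hconj.ennrealOfReal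
  refine ⟨?_, ?_⟩
  · simp_rw [hmul]
    exact hMs.integrable_mul hFs
  · have key := integral_mul_le_Lp_mul_Lq_of_nonneg hconj
      (Eventually.of_forall fun x => Real.rpow_nonneg (hM0 x) s)
      (Eventually.of_forall fun x => Real.rpow_nonneg (hF0 x) s) hMs hFs
    rw [hpow hM0, hpow hF0] at key
    simp_rw [hmul]
    calc _ ≤ ((∫ x, M x ^ r ∂μ) ^ (1 / (r / s)) * (∫ x, F x ^ p ∂μ) ^ (1 / (p / s))) ^ (1 / s) :=
          Real.rpow_le_rpow (integral_nonneg fun x => mul_nonneg (Real.rpow_nonneg (hM0 x) s)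
            (Real.rpow_nonneg (hF0 x) s)) key (by positivity)
      _ = _ := by
          rw [Real.mul_rpow (by positivity) (by positivity), ← Real.rpow_mul hIM,
            ← Real.rpow_mul hIF]
          congr 2 <;> field_simp

theorem truncPow_rpow_le {q₀ q r b N : ℝ} (hq₀ : 0 < q₀) (hq : 0 < q) (hr : 0 < r)
    (hqr : 1 / q + 1 / r = 1 / q₀) (hb : 0 < b) (hN : 0 ≤ N) (t : ℝ) :
    truncPow (q / r) b N t ^ r
      ≤ (2 ^ (q / r + b + 1)) ^ q₀ * |truncPowPrim (q / r) b N t| ^ q₀ := by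
  have ha : 0 < q / r := by positivity
  have hm0 : 0 ≤ truncPow (q / r) b N t := truncPow_nonneg hN t
  have hrq : q₀ < r := by
    by_contra! h
    have h1 : 1 / q₀ ≤ 1 / r := one_div_le_one_div_of_le hr h
    have h2 : 0 < 1 / q := by positivity
    linarith
  have hexp : q / r * (r - q₀) = q₀ := by
    field_simp at hqr ⊢
    linarith
  calc truncPow (q / r) b N t ^ r
      = truncPow (q / r) b N t ^ (r - q₀) * truncPow (q / r) b N t ^ q₀ := by
        rw [← Real.rpow_add_of_nonneg hm0 (by linarith) hq₀.le, sub_add_cancel]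
    _ ≤ (|t| ^ (q / r)) ^ (r - q₀) * truncPow (q / r) b N t ^ q₀ := by
        gcongr
        exact truncPow_le_rpow_left t
    _ = (|t| * truncPow (q / r) b N t) ^ q₀ := by
        rw [← Real.rpow_mul (abs_nonneg t), hexp, Real.mul_rpow (abs_nonneg t) hm0]
    _ ≤ (2 ^ (q / r + b + 1) * |truncPowPrim (q / r) b N t|) ^ q₀ := by
        exact Real.rpow_le_rpow (mul_nonneg (abs_nonneg t) hm0)
          (abs_mul_truncPow_le ha hb hN t) hq₀.le
    _ = _ := Real.mul_rpow (by positivity) (abs_nonneg _)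

/-- If the truncated powers of `f` satisfy a Sobolev-type bound with exponents `p₀, q₀`, then `f`
satisfies it with the shifted exponents `p, q`. -/
theorem integral_rpow_le_of_truncPow {α : Type*} [MeasurableSpace α] {μ : Measure α}
    {f g : α → ℝ} (hf : AEStronglyMeasurable f μ) (hg : AEStronglyMeasurable g μ)
    (hg0 : ∀ x, 0 ≤ g x) {p₀ q₀ p q r C : ℝ} (hp₀ : 0 < p₀) (hq₀ : 0 < q₀) (hp : 0 < p)
    (hq : 0 < q) (hr : 0 < r) (hC : 0 ≤ C) (hrp : 1 / r + 1 / p = 1 / p₀)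
    (hqr : 1 / q + 1 / r = 1 / q₀) (hfi : Integrable (fun x => |f x| ^ p) μ)
    (hgi : Integrable (fun x => g x ^ p) μ)
    (H : ∀ N : ℕ, Integrable (fun x => |truncPowPrim (q / r) (p / r) N (f x)| ^ p₀) μ →
      Integrable (fun x => (truncPow (q / r) (p / r) N (f x) * g x) ^ p₀) μ →
      Integrable (fun x => |truncPowPrim (q / r) (p / r) N (f x)| ^ q₀) μ ∧
      (∫ x, |truncPowPrim (q / r) (p / r) N (f x)| ^ q₀ ∂μ) ^ (1 / q₀) ≤
        C * ((∫ x, |truncPowPrim (q / r) (p / r) N (f x)| ^ p₀ ∂μ) ^ (1 / p₀)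
          + (∫ x, (truncPow (q / r) (p / r) N (f x) * g x) ^ p₀ ∂μ) ^ (1 / p₀))) :
    Integrable (fun x => |f x| ^ q) μ ∧
      (∫ x, |f x| ^ q ∂μ) ^ (1 / q) ≤ 2 ^ (q / r + p / r + 1) * C
        * ((∫ x, |f x| ^ p ∂μ) ^ (1 / p) + (∫ x, g x ^ p ∂μ) ^ (1 / p)) := by
  set a := q / r with ha_def
  set b := p / r with hb_def
  have ha : 0 < a := by positivity
  have hb : 0 < b := by positivity
  set κ : ℝ := 2 ^ (a + b + 1) with hκ
  have hκ0 : 0 ≤ κ := by positivity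
  set A := (∫ x, |f x| ^ p ∂μ) ^ (1 / p) + (∫ x, g x ^ p ∂μ) ^ (1 / p) with hA
  have hA0 : 0 ≤ A := add_nonneg
    (Real.rpow_nonneg (integral_nonneg fun x => by positivity) _)
    (Real.rpow_nonneg (integral_nonneg fun x => Real.rpow_nonneg (hg0 x) _) _)
  have hMm : ∀ N : ℝ, AEStronglyMeasurable (fun x => truncPow a b N (f x)) μ := fun N =>
    (continuous_truncPow ha hb).comp_aestronglyMeasurable hf
  have hPm : ∀ N : ℝ, AEStronglyMeasurable (fun x => truncPowPrim a b N (f x)) μ := fun N =>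
    (continuous_iff_continuousAt.2 fun t =>
      (hasDerivAt_truncPowPrim ha hb t).continuousAt).comp_aestronglyMeasurable hf
  have hMi : ∀ N : ℕ, Integrable (fun x => truncPow a b N (f x) ^ r) μ := by
    intro N
    refine (hfi.const_mul ((N : ℝ) ^ r)).mono'
      ((hMm N).aemeasurable.pow_const r).aestronglyMeasurable (Eventually.of_forall fun x => ?_)
    have h0 : 0 ≤ truncPow a b N (f x) := truncPow_nonneg N.cast_nonneg _
    rw [Real.norm_of_nonneg (by positivity)]
    calc _ ≤ (N * |f x| ^ b) ^ r := by
          gcongr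
          exact truncPow_le_rpow_right _
      _ = _ := by
          rw [Real.mul_rpow N.cast_nonneg (by positivity), ← Real.rpow_mul (abs_nonneg _),
            hb_def, div_mul_cancel₀ _ hr.ne']
  have hbound : ∀ N : ℕ, ∫ x, truncPow a b N (f x) ^ r ∂μ ≤ (κ * C * A) ^ q := by
    intro N
    have hN0 : (0 : ℝ) ≤ N := N.cast_nonneg
    set J := ∫ x, truncPow a b N (f x) ^ r ∂μ with hJ
    have hJ0 : 0 ≤ J := integral_nonneg fun x => Real.rpow_nonneg (truncPow_nonneg hN0 _) _
    obtain ⟨hi1, hl1⟩ := integral_mul_rpow_le (hMm N) hf.norm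
      (fun x => truncPow_nonneg hN0 _) (fun x => norm_nonneg _) hr hp hp₀ hrp (hMi N) hfi
    obtain ⟨hi2, hl2⟩ := integral_mul_rpow_le (hMm N) hg
      (fun x => truncPow_nonneg hN0 _) hg0 hr hp hp₀ hrp (hMi N) hgi
    have hle : ∀ x, |truncPowPrim a b N (f x)| ^ p₀ ≤ (truncPow a b N (f x) * ‖f x‖) ^ p₀ := by
      intro x
      gcongr
      rw [mul_comm]
      exact abs_truncPowPrim_le ha hb hN0 _
    have hi3 : Integrable (fun x => |truncPowPrim a b N (f x)| ^ p₀) μ := by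
      refine hi1.mono' ((hPm N).norm.aemeasurable.pow_const p₀).aestronglyMeasurable
        (Eventually.of_forall fun x => ?_)
      rw [Real.norm_of_nonneg (by positivity)]
      exact hle x
    have hl3 : (∫ x, |truncPowPrim a b N (f x)| ^ p₀ ∂μ) ^ (1 / p₀)
        ≤ J ^ (1 / r) * (∫ x, |f x| ^ p ∂μ) ^ (1 / p) :=
      (Real.rpow_le_rpow (integral_nonneg fun x => by positivity)
        (integral_mono hi3 hi1 hle) (by positivity)).trans hl1
    obtain ⟨hi4, hl4⟩ := H N hi3 hi2
    set X := ∫ x, |truncPowPrim a b N (f x)| ^ q₀ ∂μ with hX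
    have hX0 : 0 ≤ X := integral_nonneg fun x => by positivity
    have hJX : J ≤ κ ^ q₀ * X := by
      rw [hJ, hX, ← integral_const_mul]
      exact integral_mono (hMi N) (hi4.const_mul _) fun x =>
        truncPow_rpow_le hq₀ hq hr hqr hb hN0 (f x)
    have hmain : J ^ (1 / q₀) ≤ κ * C * A * J ^ (1 / r) := by
      calc J ^ (1 / q₀) ≤ (κ ^ q₀ * X) ^ (1 / q₀) := by gcongr
        _ = κ * X ^ (1 / q₀) := by
            rw [Real.mul_rpow (by positivity) hX0, ← Real.rpow_mul hκ0,
              mul_one_div_cancel hq₀.ne', Real.rpow_one]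
        _ ≤ κ * (C * (J ^ (1 / r) * (∫ x, |f x| ^ p ∂μ) ^ (1 / p)
              + J ^ (1 / r) * (∫ x, g x ^ p ∂μ) ^ (1 / p))) := by
            gcongr
            exact hl4.trans (by gcongr)
        _ = _ := by rw [hA]; ring
    have hroot : J ^ (1 / q) ≤ κ * C * A := by
      rcases hJ0.eq_or_lt with h0 | h0
      · rw [← h0, Real.zero_rpow (by positivity)]
        positivity
      · rw [← hqr, Real.rpow_add h0] at hmain
        exact le_of_mul_le_mul_right hmain (by positivity)
    calc J = (J ^ (1 / q)) ^ q := by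
          rw [← Real.rpow_mul hJ0, one_div_mul_cancel hq.ne', Real.rpow_one]
      _ ≤ _ := by gcongr
  have hlin : ∫⁻ x, ENNReal.ofReal (|f x| ^ q) ∂μ ≤ ENNReal.ofReal ((κ * C * A) ^ q) := by
    have hpt : ∀ x, Tendsto (fun N : ℕ => ENNReal.ofReal (truncPow a b N (f x) ^ r)) atTop
        (𝓝 (ENNReal.ofReal (|f x| ^ q))) := by
      intro x
      refine ENNReal.tendsto_ofReal ?_
      have := (tendsto_truncPow (b := b) ha (f x)).rpow_const (p := r) (Or.inr hr.le)
      rwa [← Real.rpow_mul (abs_nonneg _), ha_def, div_mul_cancel₀ _ hr.ne'] at this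
    calc ∫⁻ x, ENNReal.ofReal (|f x| ^ q) ∂μ
        = ∫⁻ x, liminf (fun N : ℕ => ENNReal.ofReal (truncPow a b N (f x) ^ r)) atTop ∂μ :=
          lintegral_congr fun x => (hpt x).liminf_eq.symm
      _ ≤ liminf (fun N : ℕ => ∫⁻ x, ENNReal.ofReal (truncPow a b N (f x) ^ r) ∂μ) atTop :=
          lintegral_liminf_le' fun N => ((hMm N).aemeasurable.pow_const r).ennreal_ofReal
      _ ≤ _ := by
          refine liminf_le_of_le (by isBoundedDefault) fun y hy => ?_
          obtain ⟨N, hN⟩ := hy.exists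
          refine hN.trans ?_
          rw [← ofReal_integral_eq_lintegral_ofReal (hMi N) (Eventually.of_forall fun x =>
            Real.rpow_nonneg (truncPow_nonneg N.cast_nonneg _) _)]
          exact ENNReal.ofReal_le_ofReal (hbound N)
  have hfm : AEStronglyMeasurable (fun x => |f x| ^ q) μ :=
    (hf.norm.aemeasurable.pow_const q).aestronglyMeasurable
  have hf0 : 0 ≤ᵐ[μ] fun x => |f x| ^ q := Eventually.of_forall fun x => by positivity
  refine ⟨⟨hfm, (hasFiniteIntegral_iff_ofReal hf0).2 (hlin.trans_lt ENNReal.ofReal_lt_top)⟩, ?_⟩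
  have hint : ∫ x, |f x| ^ q ∂μ ≤ (κ * C * A) ^ q := by
    rw [integral_eq_lintegral_of_nonneg_ae hf0 hfm]
    exact ENNReal.toReal_le_of_le_ofReal (by positivity) hlin
  calc _ ≤ ((κ * C * A) ^ q) ^ (1 / q) :=
        Real.rpow_le_rpow (integral_nonneg fun x => by positivity) hint (by positivity)
    _ = _ := by
        rw [← Real.rpow_mul (by positivity), mul_one_div_cancel hq.ne', Real.rpow_one]

/-- Integrability and integrals against the measure with density a weight. -/
theorem integrable_withDensity_weight {n : ℕ} {D : Set (Euc n)} {w : Euc n → ℝ}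
    (hw : IsWeight w) (F : Euc n → ℝ) :
    (Integrable F ((volume.restrict D).withDensity fun x => ENNReal.ofReal (w x)) ↔
      IntegrableOn (fun x => F x * w x) D) ∧
    ∫ x, F x ∂((volume.restrict D).withDensity fun x => ENNReal.ofReal (w x))
      = ∫ x in D, F x * w x := by
  have hwm : AEMeasurable (fun x => ENNReal.ofReal (w x)) (volume.restrict D) :=
    hw.locInt.aestronglyMeasurable.aemeasurable.restrict.ennreal_ofReal
  have hfin : ∀ᵐ x ∂(volume.restrict D), ENNReal.ofReal (w x) < ⊤ :=
    Eventually.of_forall fun _ => ENNReal.ofReal_lt_top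
  have hsmul : ∀ x, (ENNReal.ofReal (w x)).toReal • F x = F x * w x := fun x => by
    rw [ENNReal.toReal_ofReal (hw.nonneg x), smul_eq_mul, mul_comm]
  refine ⟨?_, ?_⟩
  · rw [integrable_withDensity_iff_integrable_smul₀' hwm hfin]
    simp_rw [hsmul]
    rfl
  · rw [integral_withDensity_eq_integral_toReal_smul₀ hwm hfin]
    simp_rw [hsmul]

/-- Composition with `truncPowPrim` maps into `W^1_s` as soon as the relevant powers are
summable. -/
theorem MemW1p.truncPowPrim_comp {n : ℕ} {D : Set (Euc n)} (hD : IsOpen D) {w f : Euc n → ℝ}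
    {G : Euc n → Euc n} (hf : LocallyIntegrableOn f D) (hG : IsWeakGradient D f G)
    (hGi : ∀ i, LocallyIntegrableOn (fun x => G x i) D) {a b N s : ℝ} (ha : 0 < a) (hb : 0 < b)
    (hN : 0 ≤ N) (hfi : IntegrableOn (fun x => |truncPowPrim a b N (f x)| ^ s * w x) D)
    (hgi : IntegrableOn (fun x => (truncPow a b N (f x) * ‖G x‖) ^ s * w x) D) :
    MemW1p D w s (fun x => truncPowPrim a b N (f x)) fun x => truncPow a b N (f x) • G x where
  locInt := by
    have hc : Continuous (truncPowPrim a b N) := continuous_iff_continuousAt.2 fun t =>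
      (hasDerivAt_truncPowPrim ha hb t).continuousAt
    have hle : ∀ x, ‖truncPowPrim a b N (f x)‖ ≤ ‖N * f x‖ := fun x => by
      rw [norm_mul, mul_comm, Real.norm_of_nonneg hN]
      exact (abs_truncPowPrim_le ha hb hN _).trans
        (mul_le_mul_of_nonneg_left (truncPow_le_const _) (abs_nonneg _))
    intro x hx
    obtain ⟨u, hu, hfu⟩ := hf x hx
    exact ⟨u, hu, (hfu.const_mul N).mono (hc.comp_aestronglyMeasurable hfu.aestronglyMeasurable)
      (Eventually.of_forall hle)⟩
  grad := fun i => by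
    refine (hG i).comp hD hf (hGi i) (hasDerivAt_truncPowPrim ha hb) (continuous_truncPow ha hb)
      (L := N) (fun t => ?_) (by simp [truncPowPrim])
    rw [abs_of_nonneg (truncPow_nonneg hN t)]
    exact truncPow_le_const t
  int_f := hfi
  int_g := by
    simp_rw [norm_smul, Real.norm_of_nonneg (truncPow_nonneg hN _)]
    exact hgi

/-- **Lemma 3.** Let `D` be a domain in `ℝⁿ` with weight `w`. Suppose for some
`p₀, q₀ ≥ 1` the embedding `W^1_{p₀}(D,w) ↪ L_{q₀}(D,w)` is bounded. If `p ≥ p₀`,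
`1/p > 1/p₀ - 1/q₀` and `1/p - 1/q = 1/p₀ - 1/q₀`, then `W^1_p(D,w) ↪ L_q(D,w)` is
bounded as well. -/
theorem bounded_embedding_exponent_shift
    (n : ℕ) (D : Set (Euc n)) (hD : IsOpen D ∧ IsConnected D)
    (w : Euc n → ℝ) (hw : IsWeight w)
    (p₀ q₀ p q : ℝ) (hp₀ : 1 ≤ p₀) (hq₀ : 1 ≤ q₀)
    (h : BddEmb D w w p₀ q₀)
    (hpp₀ : p₀ ≤ p) (hpc : 1 / p > 1 / p₀ - 1 / q₀)
    (hq : 1 / p - 1 / q = 1 / p₀ - 1 / q₀) :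
    BddEmb D w w p q := by
  have hq0 : 0 < q := one_div_pos.1 (by linarith)
  rcases hpp₀.eq_or_lt with rfl | hlt
  · have hqq : q = q₀ := by
      have h1 : 1 / q = 1 / q₀ := by linarith
      simpa using h1
    rwa [hqq]
  have hp₀0 : 0 < p₀ := by linarith
  have hq₀0 : 0 < q₀ := by linarith
  have hp0 : 0 < p := by linarith
  obtain ⟨r, hr0, hr⟩ : ∃ r : ℝ, 0 < r ∧ 1 / r = 1 / p₀ - 1 / p :=
    ⟨(1 / p₀ - 1 / p)⁻¹, inv_pos.2 (sub_pos.2 (one_div_lt_one_div_of_lt hp₀0 hlt)), by simp⟩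
  have ha : 0 < q / r := by positivity
  have hb : 0 < p / r := by positivity
  obtain ⟨C, hC, hemb⟩ := h
  refine ⟨2 ^ (q / r + p / r + 1) * C, by positivity, fun f G hfG => ?_⟩
  obtain ⟨G', hG', hG'i, hG'le⟩ := hfG.grad.exists_locallyIntegrableOn hD.1 hfG.locInt
  set μ := (volume.restrict D).withDensity fun x => ENNReal.ofReal (w x) with hμ
  have hI : ∀ {F : Euc n → ℝ}, Integrable F μ ↔ IntegrableOn (fun x => F x * w x) D :=
    fun {F} => (integrable_withDensity_weight hw F).1
  have hE : ∀ F : Euc n → ℝ, ∫ x in D, F x * w x = ∫ x, F x ∂μ :=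
    fun F => (integrable_withDensity_weight hw F).2.symm
  have hac : μ ≪ volume.restrict D := withDensity_absolutelyContinuous _ _
  have hfm : AEStronglyMeasurable f μ := hfG.locInt.aestronglyMeasurable.mono_ac hac
  have hgm : AEStronglyMeasurable (fun x => ‖G' x‖) μ := by
    simp_rw [EuclideanSpace.norm_eq]
    exact Real.continuous_sqrt.comp_aestronglyMeasurable
      (Finset.aestronglyMeasurable_fun_sum _ fun i _ =>
        ((hG'i i).aestronglyMeasurable.mono_ac hac).norm.pow 2)
  have hfi : Integrable (fun x => |f x| ^ p) μ := hI.2 hfG.int_f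
  have hGi : Integrable (fun x => ‖G x‖ ^ p) μ := hI.2 hfG.int_g
  have hle : ∀ x, ‖G' x‖ ^ p ≤ ‖G x‖ ^ p := fun x =>
    Real.rpow_le_rpow (norm_nonneg _) (hG'le x) hp0.le
  have hgi : Integrable (fun x => ‖G' x‖ ^ p) μ :=
    hGi.mono' (hgm.aemeasurable.pow_const p).aestronglyMeasurable
      (Eventually.of_forall fun x => by
        rw [Real.norm_of_nonneg (by positivity)]
        exact hle x)
  obtain ⟨hi, hb'⟩ := integral_rpow_le_of_truncPow hfm hgm (fun x => norm_nonneg _) hp₀0 hq₀0 hp0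
    hq0 hr0 hC.le (by linarith) (by linarith) hfi hgi fun N h1 h2 => by
      obtain ⟨h3, h4⟩ := hemb _ _ (MemW1p.truncPowPrim_comp hD.1 hfG.locInt hG' hG'i ha hb
        N.cast_nonneg (hI.1 h1) (hI.1 h2))
      refine ⟨hI.2 h3, ?_⟩
      simp only [W1Norm, wLpNorm, norm_smul, abs_mul, abs_norm,
        Real.norm_eq_abs, abs_of_nonneg (truncPow_nonneg (Nat.cast_nonneg N) _)] at h4
      simpa only [hE] using h4
  refine ⟨hI.1 hi, ?_⟩
  simp only [W1Norm, wLpNorm, abs_norm, hE]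
  refine hb'.trans ?_
  gcongr 2 ^ (q / r + p / r + 1) * C * (_ + ?_)
  exact Real.rpow_le_rpow (integral_nonneg fun x => by positivity)
    (integral_mono hgi hGi hle) (by positivity)
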